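/- In a weighted resource buying game all of whose cost functions are marginally non-decreasing, greedy best-response insertion yields a pure Nash equilibrium: insert the players in the order 1,…,n; when player i is inserted, let ℓ_e^{<i} = Σ_{j<i, e∈S_j} d_j, let player i choose a configuration S_i ∈ 𝒮_i minimizing Σ_{e∈S} (c_e(ℓ_e^{<i} + d_i) − c_e(ℓ_e^{<i})) over all S ∈ 𝒮_i, and set p_i^e = c_e(ℓ_e^{<i} + d_i) − c_e(ℓ_e^{<i}) for e ∈ S_i and p_i^e = 0 otherwise. Then the resulting strategy profile (S,p) with S = (S_1,…,S_n) is a pure Nash equilibrium. -/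

import Mathlib

open Finset

noncomputable section

variable {ι E : Type*}

/-- Load of resource `e` under configuration profile `S` with demands `d`. -/
def loadOf [Fintype ι] [DecidableEq E] (d : ι → ℝ) (S : ι → Finset E) (e : E) : ℝ :=
  ∑ i ∈ Finset.univ.filter (fun i => e ∈ S i), d i

/-- Resource `e` is bought under the strategy profile `(S, p)`. -/
def Bought [Fintype ι] [DecidableEq E] (d : ι → ℝ) (c : E → ℝ → ℝ)
    (S : ι → Finset E) (p : ι → E → ℝ) (e : E) : Prop :=
  c e (loadOf d S e) ≤ ∑ i, p i e

open scoped Classical in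
/-- Private cost of player `i` under strategy profile `(S, p)`:
the total payment of `i` if all resources of `S i` are bought, and `⊤` otherwise. -/
def privCost [Fintype ι] [Fintype E] [DecidableEq E] (d : ι → ℝ) (c : E → ℝ → ℝ)
    (S : ι → Finset E) (p : ι → E → ℝ) (i : ι) : EReal :=
  if ∀ e ∈ S i, Bought d c S p e then ((∑ e, p i e : ℝ) : EReal) else ⊤

/-- `(S, p)` is a pure Nash equilibrium of the weighted resource buying game with
configuration families `conf`, demands `d` and cost functions `c`. -/
def IsPNE [Fintype ι] [Fintype E] [DecidableEq ι] [DecidableEq E]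
    (conf : ι → Set (Finset E)) (d : ι → ℝ) (c : E → ℝ → ℝ)
    (S : ι → Finset E) (p : ι → E → ℝ) : Prop :=
  (∀ i, S i ∈ conf i) ∧ (∀ i e, 0 ≤ p i e) ∧
  ∀ i (S' : Finset E) (p' : E → ℝ), S' ∈ conf i → (∀ e, 0 ≤ p' e) →
    privCost d c S p i ≤ privCost d c (Function.update S i S') (Function.update p i p') i

/-- `c` is nondecreasing (as a cost function on nonnegative reals). -/
def NondecrOn (c : ℝ → ℝ) : Prop := ∀ x y : ℝ, 0 ≤ x → x ≤ y → c x ≤ c y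

/-- `c` is nonnegative (as a cost function on nonnegative reals). -/
def NonnegOn (c : ℝ → ℝ) : Prop := ∀ x : ℝ, 0 ≤ x → 0 ≤ c x

/-- `c` has non-increasing marginal costs. -/
def MargNonincr (c : ℝ → ℝ) : Prop :=
  ∀ x y δ : ℝ, 0 ≤ x → x ≤ y → 0 ≤ δ → c (y + δ) - c y ≤ c (x + δ) - c x

/-- `c` has non-decreasing marginal costs. -/
def MargNondecr (c : ℝ → ℝ) : Prop :=
  ∀ x y δ : ℝ, 0 ≤ x → x ≤ y → 0 ≤ δ → c (x + δ) - c x ≤ c (y + δ) - c y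

/-- Social cost of a configuration profile. -/
def socCost [Fintype ι] [Fintype E] [DecidableEq E] (d : ι → ℝ) (c : E → ℝ → ℝ)
    (S : ι → Finset E) : ℝ :=
  ∑ e, c e (loadOf d S e)


/-- `ℓ_e^{≤ i}(S)`: the load on `e` from players `j ≤ i` using `e`. -/
def loadUpto {n : ℕ} [DecidableEq E] (d : Fin n → ℝ) (S : Fin n → Finset E)
    (e : E) (i : Fin n) : ℝ :=
  ∑ j ∈ Finset.univ.filter (fun j => j ≤ i ∧ e ∈ S j), d j

/-- `ℓ_e^{< i}(S)` (that is, `ℓ_e^{≤ i-1}(S)`): the load on `e` from players `j < i`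
using `e`. -/
def loadBelow {n : ℕ} [DecidableEq E] (d : Fin n → ℝ) (S : Fin n → Finset E)
    (e : E) (i : Fin n) : ℝ :=
  ∑ j ∈ Finset.univ.filter (fun j => j < i ∧ e ∈ S j), d j

/-- Marginal cost pricing with respect to the profile `S` and the natural order of the
players `1, …, n`. -/
def mcPricing {n : ℕ} [Fintype E] [DecidableEq E] (c : E → ℝ → ℝ) (d : Fin n → ℝ)
    (S : Fin n → Finset E) : Fin n → E → ℝ :=
  fun i e => if e ∈ S i then c e (loadUpto d S e i) - c e (loadBelow d S e i) else 0

/-- Greedy marginal payments on a resource add up to its cost. -/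
theorem sum_marginal_eq_cost {n : ℕ} {E : Type*} [DecidableEq E] (d : Fin n → ℝ)
    (S : Fin n → Finset E) (e : E) (c : ℝ → ℝ) (hc : c 0 = 0) :
    ∑ i, (if e ∈ S i then c (loadBelow d S e i + d i) - c (loadBelow d S e i) else 0) =
      c (loadOf d S e) := by
  let g : ℕ → ℝ := fun k => ∑ j ∈ univ.filter (fun j : Fin n => (j : ℕ) < k ∧ e ∈ S j), d j
  have hstep : ∀ i : Fin n, g (i + 1) = g i + if e ∈ S i then d i else 0 := by
    intro i
    have hi : (if e ∈ S i then d i else 0) =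
        ∑ j, if j = i then (if e ∈ S j then d j else 0) else 0 := by simp
    simp only [g, sum_filter]
    rw [hi, ← sum_add_distrib]
    refine sum_congr rfl fun j _ => ?_
    by_cases hj : j = i
    · subst hj
      simp
    · have hlt : (j : ℕ) < i + 1 ↔ (j : ℕ) < i := by
        have := Fin.val_ne_of_ne hj
        omega
      simp [hlt, hj]
  have hbelow : ∀ i : Fin n, loadBelow d S e i = g i := fun i => rfl
  have hterm : ∀ i : Fin n,
      (if e ∈ S i then c (loadBelow d S e i + d i) - c (loadBelow d S e i) else 0) =
        c (g (i + 1)) - c (g i) := by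
    intro i
    rw [hbelow, hstep]
    split_ifs <;> simp
  have hn : g n = loadOf d S e := by simp [g, loadOf]
  have h0 : g 0 = 0 := by simp [g]
  rw [sum_congr rfl fun i _ => hterm i, ← sum_range fun k => c (g (k + 1)) - c (g k),
    sum_range_sub (fun k => c (g k)), hn, h0, hc, sub_zero]

theorem loadBelow_nonneg {n : ℕ} {E : Type*} [DecidableEq E] (d : Fin n → ℝ)
    (hd : ∀ i, 0 < d i) (S : Fin n → Finset E) (e : E) (i : Fin n) :
    0 ≤ loadBelow d S e i :=
  sum_nonneg fun j _ => (hd j).le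

theorem loadBelow_le_loadOf {n : ℕ} {E : Type*} [DecidableEq E] (d : Fin n → ℝ)
    (hd : ∀ i, 0 < d i) (S : Fin n → Finset E) (e : E) (i : Fin n) :
    loadBelow d S e i ≤ loadOf d S e :=
  sum_le_sum_of_subset_of_nonneg (monotone_filter_right _ fun _ _ h => h.2)
    fun j _ _ => (hd j).le

/-- The load on a resource `e` of `T` after player `i` switches to the configuration `T`. -/
theorem loadOf_update {ι E : Type*} [Fintype ι] [DecidableEq ι] [DecidableEq E] (d : ι → ℝ)
    (S : ι → Finset E) (i : ι) (T : Finset E) (e : E) (he : e ∈ T) :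
    loadOf d (Function.update S i T) e = loadOf d S e + if e ∈ S i then 0 else d i := by
  have hi : (if e ∈ S i then 0 else d i) =
      ∑ j, if j = i then (if e ∈ S j then 0 else d j) else 0 := by simp
  simp only [loadOf, sum_filter]
  rw [hi, ← sum_add_distrib]
  refine sum_congr rfl fun j _ => ?_
  by_cases hj : j = i
  · subst hj
    by_cases h : e ∈ S j <;> simp [he, h]
  · simp [hj]

theorem sum_update_payment {ι E : Type*} [Fintype ι] [DecidableEq ι]
    (p : ι → E → ℝ) (i : ι) (q : E → ℝ) (e : E) :
    ∑ j, Function.update p i q j e = ∑ j, p j e - p i e + q e := by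
  have h : ∀ j ∈ univ.erase i, Function.update p i q j e = p j e := fun j hj => by
    rw [Function.update_of_ne (ne_of_mem_erase hj)]
  rw [← add_sum_erase univ (fun j => Function.update p i q j e) (mem_univ i),
    ← add_sum_erase univ (fun j => p j e) (mem_univ i), sum_congr rfl h]
  simp
  ring

/-- In a weighted resource buying game with (nondecreasing, normalized)
marginally non-decreasing cost functions, greedy best-response insertion of the players
in the order `1, …, n`, with each inserted player paying the marginal cost of her chosen
configuration, yields a pure Nash equilibrium. -/
theorem statement8 {n : ℕ} {E : Type*} [Fintype E] [DecidableEq E]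
    (conf : Fin n → Set (Finset E)) (hconf : ∀ i, (conf i).Nonempty)
    (d : Fin n → ℝ) (hd : ∀ i, 0 < d i) (c : E → ℝ → ℝ)
    (hmono : ∀ e, NondecrOn (c e)) (hzero : ∀ e, c e 0 = 0)
    (hnonneg : ∀ e, NonnegOn (c e)) (hMND : ∀ e, MargNondecr (c e))
    (S : Fin n → Finset E) (hS : ∀ i, S i ∈ conf i)
    (hbest : ∀ i, ∀ T ∈ conf i,
      ∑ e ∈ S i, (c e (loadBelow d S e i + d i) - c e (loadBelow d S e i)) ≤
        ∑ e ∈ T, (c e (loadBelow d S e i + d i) - c e (loadBelow d S e i)))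
    (p : Fin n → E → ℝ)
    (hp : p = fun i e =>
      if e ∈ S i then c e (loadBelow d S e i + d i) - c e (loadBelow d S e i) else 0) :
    IsPNE conf d c S p := by
  have htotal : ∀ e, ∑ i, p i e = c e (loadOf d S e) := fun e => by
    rw [hp]
    exact sum_marginal_eq_cost d S e (c e) (hzero e)
  refine ⟨hS, fun i e => ?_, fun i T q hT hq => ?_⟩
  · rw [hp]
    dsimp only
    split_ifs
    · exact sub_nonneg.2 (hmono e _ _ (loadBelow_nonneg d hd S e i) (by linarith [hd i]))
    · exact le_rfl
  · unfold privCost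
    rw [if_pos (show ∀ e ∈ S i, Bought d c S p e from fun e _ => (htotal e).ge)]
    split_ifs with hbought
    · rw [EReal.coe_le_coe_iff, Function.update_self]
      rw [Function.update_self] at hbought
      have hpay : ∀ e ∈ T, c e (loadBelow d S e i + d i) - c e (loadBelow d S e i) ≤ q e := by
        intro e he
        have h := hbought e he
        rw [Bought, loadOf_update d S i T e he, sum_update_payment, htotal] at h
        have hpi := congrFun (congrFun hp i) e
        by_cases hei : e ∈ S i
        · simp only [hei, if_true, add_zero] at h hpi
          linarith
        · simp only [hei, if_false] at h hpi
          have := hMND e _ _ (d i) (loadBelow_nonneg d hd S e i)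
            (loadBelow_le_loadOf d hd S e i) (hd i).le
          linarith
      calc ∑ e, p i e
          = ∑ e ∈ S i, (c e (loadBelow d S e i + d i) - c e (loadBelow d S e i)) := by
            simp [hp]
        _ ≤ ∑ e ∈ T, (c e (loadBelow d S e i + d i) - c e (loadBelow d S e i)) :=
            hbest i T hT
        _ ≤ ∑ e ∈ T, q e := sum_le_sum hpay
        _ ≤ ∑ e, q e := sum_le_univ_sum_of_nonneg hq
    · exact le_top

end
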